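/- Let γ : Ω → (0,∞) with γ ∈ L^{q}(Ω,𝓕,ℙ) for some q > 1, and c : Ω → [0,∞) with c ∈ L^{p}(Ω,𝓕,ℙ), p > 1. Assume the decay condition: there exist a₀ > 0 and E_ω ≥ 1 with E ∈ L^{q₀}(Ω,𝓕,ℙ) such that for ℙ-a.e. ω and all n ≥ 1: max( Π_{j=0}^{n−1} γ_{σ^{j}ω}^{−1}, Π_{j=1}^{n−1} γ_{σ^{−j}ω}^{−1} ) ≤ E_ω·n^{−a₀}. Assume a₀ > 1 + 1/p + 1/q₀ + 1/q, and let s be given by 1/s = 1/p + 1/q + 1/q₀. Then for every sufficiently small δ > 0 there exists a random variable C_ω ≥ 1 with C ∈ L^{t}(Ω,𝓕,ℙ), 1/t = 2/q₀ + 1/p + 1/q, such that for ℙ-a.e. ω: for every n ≥ 1 and all C⁴ real functions z₁,…,z_n on intervals whose composition y = z_n ∘ ⋯ ∘ z₁ is defined, if ‖z_j′‖_∞ ≤ γ_{σ^{−j}ω}^{−1} and max(‖z_j″‖_∞, ‖z_j‴‖_∞, ‖z_j⁗‖_∞) ≤ c(σ^{−j}ω) for each j, then ‖y″‖_∞ ≤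 C_ω·n^{−η} with η = a₀ − 1 − 1/s − δ. Moreover, if a₀ > 1/2 and ζ := min(2a₀ − 1/s − 1/p − 2/q₀ − 1 − 4δ, 3a₀ − 3/q₀ − 2/p − 4δ) > 0, then there is A_ω ≥ 1 with A ∈ L^{u}, 1/u = 7/q₀ + 2/p + 2/q, such that ‖y‴‖_∞ ≤ A_ω·n^{−ζ}; and if κ := 4a₀ − 3 − 3/s − δ > 0, then there is R_ω ≥ 1 with R ∈ L^{u₁}, 1/u₁ = 4/q₀ + 3/s + 2/q, such that ‖y⁗‖_∞ ≤ R_ω·n^{−κ}. -/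

import Mathlib

open MeasureTheory Function

noncomputable section

/-- `C ∈ L^p(Ω,𝓕,ℙ)` for a nonnegative random variable `C`. -/
def MemLpRV {Ω : Type*} [MeasurableSpace Ω] (ℙ : Measure Ω) (p : ℝ) (C : Ω → ℝ) : Prop :=
  Measurable C ∧ (∀ ω, 0 ≤ C ω) ∧ Integrable (fun ω => C ω ^ p) ℙ

/-- The `C^r` norm of a (1-periodic) function on `ℝ`:
`max_{0 ≤ i ≤ r} sup_x |f^{(i)}(x)|`. -/
def crNorm (r : ℕ) (f : ℝ → ℝ) : ℝ :=
  ⨆ p : Fin (r + 1) × ℝ, |iteratedDeriv (p.1 : ℕ) f p.2|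

/-- The transfer operator (with respect to Lebesgue/Haar measure) of the circle map
induced by the lift `T : ℝ → ℝ`, acting on (1-periodic) functions:
`L g (x) = Σ_{y : T y = x} g(y)/|T'(y)|`, the sum running over the preimages of `x`
in a fundamental domain `[0,1)`. -/
def transferOp (T : ℝ → ℝ) (g : ℝ → ℝ) (x : ℝ) : ℝ :=
  ∑' y : {y : ℝ // y ∈ Set.Ico (0 : ℝ) 1 ∧ ∃ k : ℤ, T y = x + k}, g (y : ℝ) / |deriv T (y : ℝ)|

/-- Iterates of maps along an orbit of `σ`: `T^n_ω = T_{σ^{n-1}ω} ∘ ⋯ ∘ T_ω`. -/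
def mapIter {Ω : Type*} (σ : Ω → Ω) (T : Ω → ℝ → ℝ) : ℕ → Ω → ℝ → ℝ
  | 0, _, x => x
  | n + 1, ω, x => mapIter σ T n (σ ω) (T ω x)

/-- Iterates of the transfer operators along an orbit of `σ`:
`L^n_ω = L_{σ^{n-1}ω} ∘ ⋯ ∘ L_ω`. -/
def transferIter {Ω : Type*} (σ : Ω → Ω) (T : Ω → ℝ → ℝ) : ℕ → Ω → (ℝ → ℝ) → ℝ → ℝ
  | 0, _, g => g
  | n + 1, ω, g => transferIter σ T n (σ ω) (transferOp (T ω) g)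

/-- The composition `z_n ∘ z_{n-1} ∘ ⋯ ∘ z_1` (the empty composition is the identity). -/
def compSeq (z : ℕ → ℝ → ℝ) : ℕ → ℝ → ℝ
  | 0, x => x
  | n + 1, x => z (n + 1) (compSeq z n x)

/-- Birkhoff sums `S_n φ (x) = Σ_{j<n} φ_{σ^j ω}(T^j_ω x)` along an orbit of `σ`. -/
def birkSum {Ω : Type*} (σ : Ω → Ω) (T : Ω → ℝ → ℝ) (φ : Ω → ℝ → ℝ) (n : ℕ) (ω : Ω)
    (x : ℝ) : ℝ :=
  ∑ j ∈ Finset.range n, φ (σ^[j] ω) (mapIter σ T j ω x)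

/-- Integral over the circle (one period). -/
def circInt (g : ℝ → ℝ) : ℝ := ∫ x in Set.Ioc (0 : ℝ) 1, g x

theorem hasDerivAt_iter {f : ℝ → ℝ} (hf : ContDiff ℝ 4 f) (k : ℕ) (hk : k < 4) (x : ℝ) :
    HasDerivAt (iteratedDeriv k f) (iteratedDeriv (k+1) f x) x := by
  rw [iteratedDeriv_succ]
  exact ((hf.differentiable_iteratedDeriv k (by exact_mod_cast hk)) x).hasDerivAt

theorem comp_derivs {g f : ℝ → ℝ} (hg : ContDiff ℝ 4 g) (hf : ContDiff ℝ 4 f) :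
    (∀ x, deriv (g ∘ f) x = deriv g (f x) * deriv f x) ∧
    (∀ x, iteratedDeriv 2 (g ∘ f) x = iteratedDeriv 2 g (f x) * deriv f x ^ 2
      + deriv g (f x) * iteratedDeriv 2 f x) ∧
    (∀ x, iteratedDeriv 3 (g ∘ f) x = iteratedDeriv 3 g (f x) * deriv f x ^ 3
      + 3 * iteratedDeriv 2 g (f x) * deriv f x * iteratedDeriv 2 f x
      + deriv g (f x) * iteratedDeriv 3 f x) ∧
    (∀ x, iteratedDeriv 4 (g ∘ f) x = iteratedDeriv 4 g (f x) * deriv f x ^ 4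
      + 6 * iteratedDeriv 3 g (f x) * deriv f x ^ 2 * iteratedDeriv 2 f x
      + 3 * iteratedDeriv 2 g (f x) * iteratedDeriv 2 f x ^ 2
      + 4 * iteratedDeriv 2 g (f x) * deriv f x * iteratedDeriv 3 f x
      + deriv g (f x) * iteratedDeriv 4 f x) := by
  have g0 := hasDerivAt_iter hg 0 (by norm_num)
  have g1 := hasDerivAt_iter hg 1 (by norm_num)
  have g2 := hasDerivAt_iter hg 2 (by norm_num)
  have g3 := hasDerivAt_iter hg 3 (by norm_num)
  have f0 := hasDerivAt_iter hf 0 (by norm_num)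
  have f1 := hasDerivAt_iter hf 1 (by norm_num)
  have f2 := hasDerivAt_iter hf 2 (by norm_num)
  have f3 := hasDerivAt_iter hf 3 (by norm_num)
  simp only [iteratedDeriv_zero, zero_add, iteratedDeriv_one, Nat.reduceAdd] at *
  have h1 : ∀ x, HasDerivAt (g ∘ f) (deriv g (f x) * deriv f x) x :=
    fun x => (g0 (f x)).comp x (f0 x)
  have e1 : deriv (g ∘ f) = fun x => deriv g (f x) * deriv f x := funext fun x => (h1 x).deriv
  have h2 : ∀ x, HasDerivAt (deriv (g ∘ f)) (iteratedDeriv 2 g (f x) * deriv f x ^ 2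
      + deriv g (f x) * iteratedDeriv 2 f x) x := by
    intro x
    rw [e1]
    refine (((g1 (f x)).comp x (f0 x)).mul (f1 x)).congr_deriv ?_
    simp only [Function.comp]
    ring
  have e2 : iteratedDeriv 2 (g ∘ f) = fun x => iteratedDeriv 2 g (f x) * deriv f x ^ 2
      + deriv g (f x) * iteratedDeriv 2 f x := by
    funext x
    rw [iteratedDeriv_succ, iteratedDeriv_one]
    exact (h2 x).deriv
  have h3 : ∀ x, HasDerivAt (iteratedDeriv 2 (g ∘ f)) (iteratedDeriv 3 g (f x) * deriv f x ^ 3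
      + 3 * iteratedDeriv 2 g (f x) * deriv f x * iteratedDeriv 2 f x
      + deriv g (f x) * iteratedDeriv 3 f x) x := by
    intro x
    rw [e2]
    refine ((((g2 (f x)).comp x (f0 x)).mul ((f1 x).pow 2)).add
      (((g1 (f x)).comp x (f0 x)).mul (f2 x))).congr_deriv ?_
    simp only [Function.comp, Pi.pow_apply]
    push_cast
    ring
  have e3 : iteratedDeriv 3 (g ∘ f) = fun x => iteratedDeriv 3 g (f x) * deriv f x ^ 3
      + 3 * iteratedDeriv 2 g (f x) * deriv f x * iteratedDeriv 2 f x
      + deriv g (f x) * iteratedDeriv 3 f x := by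
    funext x
    rw [iteratedDeriv_succ]
    exact (h3 x).deriv
  refine ⟨fun x => (h1 x).deriv, fun x => congrFun e2 x, fun x => congrFun e3 x, fun x => ?_⟩
  rw [iteratedDeriv_succ, e3]
  refine HasDerivAt.deriv ?_
  refine (((((g3 (f x)).comp x (f0 x)).mul ((f1 x).pow 3)).add
      (((((g2 (f x)).comp x (f0 x)).const_mul 3).mul (f1 x)).mul (f2 x))).add
      (((g1 (f x)).comp x (f0 x)).mul (f3 x))).congr_deriv ?_
  simp only [Function.comp, Pi.pow_apply, Pi.mul_apply]
  push_cast
  ring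

theorem compSeq_bounds (b c : ℕ → ℝ) (hb : ∀ i, 0 < b i) (hc : ∀ i, 0 ≤ c i) (P T : ℕ → ℝ)
    (hP0 : P 0 = 1) (hP : ∀ i, P (i+1) = P i * b i) (hT0 : T 0 = 0)
    (hT : ∀ i, T (i+1) = T i + c i / b i * P i) (M S : ℝ) (hM : ∀ i, P i ≤ M)
    (hS : ∀ i, T i ≤ S) (n : ℕ) (z : ℕ → ℝ → ℝ)
    (hz : ∀ j, 1 ≤ j → j ≤ n → ContDiff ℝ 4 (z j))
    (hzb : ∀ j, 1 ≤ j → j ≤ n → ∀ x : ℝ, |deriv (z j) x| ≤ b (j-1) ∧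
      |iteratedDeriv 2 (z j) x| ≤ c (j-1) ∧ |iteratedDeriv 3 (z j) x| ≤ c (j-1) ∧
      |iteratedDeriv 4 (z j) x| ≤ c (j-1)) (k : ℕ) (hk : k ≤ n) :
    ContDiff ℝ 4 (compSeq z k) ∧ ∀ x, |deriv (compSeq z k) x| ≤ P k ∧
      |iteratedDeriv 2 (compSeq z k) x| ≤ P k * T k ∧
      |iteratedDeriv 3 (compSeq z k) x| ≤ P k * T k * (M + 3 * S) ∧
      |iteratedDeriv 4 (compSeq z k) x| ≤
        P k * T k * (M^2 + 6 * M * S + 3 * S^2 + 4 * S * (M + 3 * S)) := by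
  have hPp : ∀ i, 0 < P i := by
    intro i
    induction i with
    | zero => rw [hP0]; norm_num
    | succ i ih => rw [hP]; exact mul_pos ih (hb i)
  have hTn : ∀ i, 0 ≤ T i := by
    intro i
    induction i with
    | zero => rw [hT0]
    | succ i ih =>
      rw [hT]
      have := div_nonneg (hc i) (hb i).le
      have := mul_nonneg this (hPp i).le
      linarith
  induction k with
  | zero =>
    have e : compSeq z 0 = id := by funext x; rfl
    rw [e, hP0, hT0]
    refine ⟨contDiff_id, fun x => ?_⟩
    have d1 : deriv (id : ℝ → ℝ) = fun _ => 1 := by funext x; simp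
    have d2 : iteratedDeriv 2 (id : ℝ → ℝ) = fun _ => 0 := by
      rw [iteratedDeriv_succ, iteratedDeriv_one, d1]; simp
    have d3 : iteratedDeriv 3 (id : ℝ → ℝ) = fun _ => 0 := by
      rw [iteratedDeriv_succ, d2]; simp
    have d4 : iteratedDeriv 4 (id : ℝ → ℝ) = fun _ => 0 := by
      rw [iteratedDeriv_succ, d3]; simp
    rw [d1, d2, d3, d4]
    simp
  | succ k ih =>
    obtain ⟨hf, hfb⟩ := ih (by omega)
    have hg := hz (k+1) (by omega) hk
    have hgb := hzb (k+1) (by omega) hk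
    have e : compSeq z (k+1) = z (k+1) ∘ compSeq z k := rfl
    rw [e]
    refine ⟨hg.comp hf, fun x => ?_⟩
    obtain ⟨d1, d2, d3, d4⟩ := comp_derivs hg hf
    rw [d1, d2, d3, d4]
    obtain ⟨f1, f2, f3, f4⟩ := hfb x
    obtain ⟨g1, g2, g3, g4⟩ := hgb (compSeq z k x)
    simp only [Nat.add_sub_cancel] at g1 g2 g3 g4
    generalize deriv (compSeq z k) x = F1 at *
    generalize iteratedDeriv 2 (compSeq z k) x = F2 at *
    generalize iteratedDeriv 3 (compSeq z k) x = F3 at *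
    generalize iteratedDeriv 4 (compSeq z k) x = F4 at *
    generalize deriv (z (k+1)) (compSeq z k x) = G1 at *
    generalize iteratedDeriv 2 (z (k+1)) (compSeq z k x) = G2 at *
    generalize iteratedDeriv 3 (z (k+1)) (compSeq z k x) = G3 at *
    generalize iteratedDeriv 4 (z (k+1)) (compSeq z k x) = G4 at *
    rw [hP, hT]
    have hPk := hPp k
    have hTk := hTn k
    have hMk := hM k
    have hSk := hS k
    have hbk := hb k
    have hck := hc k
    generalize P k = p at *
    generalize T k = t at *
    generalize b k = b at *
    generalize c k = c at *
    have hM0 : 0 ≤ M := hPk.le.trans hMk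
    have hS0 : 0 ≤ S := hTk.trans hSk
    have hcb : c = c / b * b := by field_simp
    have hd : 0 ≤ c / b := div_nonneg hck hbk.le
    generalize c / b = d at *
    subst hcb
    refine ⟨?_, ?_, ?_, ?_⟩
    · rw [abs_mul, mul_comm]; gcongr
    · calc |G2 * F1 ^ 2 + G1 * F2| ≤ |G2| * |F1|^2 + |G1| * |F2| := by
            refine (abs_add_le _ _).trans ?_
            simp only [abs_mul, abs_pow]; rfl
        _ ≤ (d * b) * p^2 + b * (p * t) := by gcongr
        _ = _ := by ring
    · calc |G3 * F1 ^ 3 + 3 * G2 * F1 * F2 + G1 * F3|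
          ≤ |G3| * |F1|^3 + 3 * |G2| * |F1| * |F2| + |G1| * |F3| := by
            refine (abs_add_three _ _ _).trans ?_
            simp only [abs_mul, abs_pow, Nat.abs_ofNat]; rfl
        _ ≤ (d * b) * p^3 + 3 * (d * b) * p * (p * t) + b * (p * t * (M + 3 * S)) := by gcongr
        _ = p * b * (t * (M + 3 * S) + d * p * (p + 3 * t)) := by ring
        _ ≤ p * b * (t * (M + 3 * S) + d * p * (M + 3 * S)) := by gcongr
        _ = _ := by ring
    · calc |G4 * F1 ^ 4 + 6 * G3 * F1 ^ 2 * F2 + 3 * G2 * F2 ^ 2 + 4 * G2 * F1 * F3 + G1 * F4|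
          ≤ |G4| * |F1|^4 + 6 * |G3| * |F1|^2 * |F2| + 3 * |G2| * |F2|^2 + 4 * |G2| * |F1| * |F3|
            + |G1| * |F4| := by
            refine (abs_add_le _ _).trans ?_
            refine add_le_add ((abs_add_le _ _).trans (add_le_add (abs_add_three _ _ _) le_rfl)) le_rfl |>.trans ?_
            simp only [abs_mul, abs_pow, Nat.abs_ofNat]; rfl
        _ ≤ (d * b) * p^4 + 6 * (d * b) * p^2 * (p * t) + 3 * (d * b) * (p * t)^2
            + 4 * (d * b) * p * (p * t * (M + 3 * S))
            + b * (p * t * (M^2 + 6 * M * S + 3 * S^2 + 4 * S * (M + 3 * S))) := by gcongr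
        _ = p * b * (t * (M^2 + 6 * M * S + 3 * S^2 + 4 * S * (M + 3 * S))
            + d * p * (p^2 + 6 * p * t + 3 * t^2 + 4 * t * (M + 3 * S))) := by ring
        _ ≤ p * b * (t * (M^2 + 6 * M * S + 3 * S^2 + 4 * S * (M + 3 * S))
            + d * p * (M^2 + 6 * M * S + 3 * S^2 + 4 * S * (M + 3 * S))) := by gcongr
        _ = _ := by ring

theorem sup_lemma {Ω : Type*} [MeasurableSpace Ω] (ℙ : Measure Ω) [IsProbabilityMeasure ℙ]
    (τ : Ω → Ω) (hτ : MeasurePreserving τ ℙ ℙ) (X : Ω → ℝ) (r θ : ℝ) (hr : 0 < r)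
    (hθ : 1 < θ * r) (hX : MemLpRV ℙ r X) :
    ∃ D : Ω → ℝ, (∀ ω, 1 ≤ D ω) ∧ MemLpRV ℙ r D ∧
      ∀ᵐ ω ∂ℙ, ∀ k : ℕ, X (τ^[k] ω) ≤ D ω * ((k:ℝ) + 1) ^ θ := by
  obtain ⟨hXm, hX0, hXi⟩ := hX
  set f : ℕ → Ω → ENNReal := fun k ω =>
    ENNReal.ofReal (((k:ℝ)+1)^(-(θ*r))) * ENNReal.ofReal (X (τ^[k] ω) ^ r) with hf
  have hτk : ∀ k, MeasurePreserving (τ^[k]) ℙ ℙ := fun k => hτ.iterate k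
  have hXr : Measurable fun ω => ENNReal.ofReal (X ω ^ r) := (hXm.pow_const r).ennreal_ofReal
  have hfm : ∀ k, Measurable (f k) := fun k =>
    (hXr.comp (hτk k).measurable).const_mul _
  set G : Ω → ENNReal := fun ω => ∑' k, f k ω with hG
  have hGm : Measurable G := Measurable.tsum hfm
  have hGi : ∫⁻ ω, G ω ∂ℙ ≠ ⊤ := by
    rw [hG, lintegral_tsum (fun k => (hfm k).aemeasurable)]
    have : ∀ k, ∫⁻ ω, f k ω ∂ℙ =
        ENNReal.ofReal (((k:ℝ)+1)^(-(θ*r))) * ∫⁻ ω, ENNReal.ofReal (X ω ^ r) ∂ℙ := by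
      intro k
      rw [hf]
      simp only
      rw [← (hτk k).lintegral_comp hXr]
      exact lintegral_const_mul _ (hXr.comp (hτk k).measurable)
    simp_rw [this]
    rw [ENNReal.tsum_mul_right]
    refine ENNReal.mul_ne_top ?_ ?_
    · have hs : Summable fun k : ℕ => ((k:ℝ)+1)^(-(θ*r)) := by
        have := (summable_nat_add_iff 1).2 (Real.summable_nat_rpow.2 (by linarith : -(θ*r) < -1))
        simpa using this
      exact hs.tsum_ofReal_ne_top
    · exact hXi.lintegral_lt_top.ne
  have hD1 : ∀ ω, 1 ≤ (1 + (G ω).toReal) := fun ω => by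
    have := @ENNReal.toReal_nonneg (G ω); linarith
  refine ⟨fun ω => (1 + (G ω).toReal) ^ (1/r), fun ω => Real.one_le_rpow (hD1 ω) (by positivity),
    ⟨?_, ?_, ?_⟩, ?_⟩
  · exact (measurable_const.add hGm.ennreal_toReal).pow_const _
  · intro ω; have := hD1 ω; positivity
  · have : (fun ω => ((1 + (G ω).toReal) ^ (1/r)) ^ r) = fun ω => 1 + (G ω).toReal := by
      funext ω
      rw [← Real.rpow_mul (by linarith [hD1 ω]), one_div, inv_mul_cancel₀ hr.ne', Real.rpow_one]
    rw [this]
    exact (integrable_const _).add (integrable_toReal_of_lintegral_ne_top hGm.aemeasurable hGi)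
  · filter_upwards [ae_lt_top hGm hGi] with ω hω k
    have h1 : f k ω ≤ G ω := ENNReal.le_tsum k
    have h2 := ENNReal.toReal_mono hω.ne h1
    have hk : (0:ℝ) < (k:ℝ)+1 := by positivity
    have hXk := hX0 (τ^[k] ω)
    simp only [hf, ENNReal.toReal_mul] at h2
    rw [ENNReal.toReal_ofReal (by positivity), ENNReal.toReal_ofReal (by positivity)] at h2
    have h3 : X (τ^[k] ω) ^ r ≤ (1 + (G ω).toReal) * ((k:ℝ)+1)^(θ*r) := by
      rw [Real.rpow_neg hk.le, inv_mul_le_iff₀ (by positivity)] at h2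
      have : (0:ℝ) < ((k:ℝ)+1)^(θ*r) := by positivity
      nlinarith
    have hD := hD1 ω
    calc X (τ^[k] ω) = (X (τ^[k] ω) ^ r) ^ (1/r) := by
          rw [← Real.rpow_mul hXk, mul_one_div_cancel hr.ne', Real.rpow_one]
      _ ≤ ((1 + (G ω).toReal) * ((k:ℝ)+1)^(θ*r)) ^ (1/r) := by
          apply Real.rpow_le_rpow (by positivity) h3 (by positivity)
      _ = _ := by
          rw [Real.mul_rpow (by linarith) (by positivity), ← Real.rpow_mul hk.le, mul_assoc,
            mul_one_div_cancel hr.ne', mul_one]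

theorem prod_memLp {Ω : Type*} [MeasurableSpace Ω] (ℙ : Measure Ω) [IsProbabilityMeasure ℙ]
    (X Y : Ω → ℝ) (a b r : ℝ) (ha : 0 < a) (hb : 0 < b) (hr : 1 / r = 1/a + 1/b)
    (hX : MemLpRV ℙ a X) (hY : MemLpRV ℙ b Y) : MemLpRV ℙ r (fun ω => X ω * Y ω) := by
  obtain ⟨hXm, hX0, hXi⟩ := hX
  obtain ⟨hYm, hY0, hYi⟩ := hY
  have hr0 : 0 < r := one_div_pos.1 (by rw [hr]; positivity)
  refine ⟨hXm.mul hYm, fun ω => mul_nonneg (hX0 ω) (hY0 ω), ?_⟩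
  refine (hXi.add hYi).mono' ((hXm.mul hYm).pow_const r).aestronglyMeasurable ?_
  refine Filter.Eventually.of_forall fun ω => ?_
  have hx := hX0 ω
  have hy := hY0 ω
  rw [Real.norm_of_nonneg (by positivity)]
  have hw : r/a + r/b = 1 := by
    have : r * (1/r) = r * (1/a+1/b) := by rw [hr]
    rw [mul_one_div_cancel hr0.ne'] at this
    rw [this]; ring
  have := Real.geom_mean_le_arith_mean2_weighted (w₁ := r/a) (w₂ := r/b) (p₁ := X ω ^ a)
    (p₂ := Y ω ^ b) (by positivity) (by positivity) (by positivity) (by positivity) hw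
  rw [← Real.rpow_mul hx, ← Real.rpow_mul hy, mul_div_cancel₀ _ ha.ne', mul_div_cancel₀ _ hb.ne',
    ← Real.mul_rpow hx hy] at this
  refine this.trans ?_
  have h1 : r/a ≤ 1 := by have : 0 < r/b := by positivity
                          linarith
  have h2 : r/b ≤ 1 := by have : 0 < r/a := by positivity
                          linarith
  have h3 : 0 ≤ X ω ^ a := by positivity
  have h4 : 0 ≤ Y ω ^ b := by positivity
  simp only [Pi.add_apply]
  nlinarith

theorem mon_memLp {Ω : Type*} [MeasurableSpace Ω] (ℙ : Measure Ω) [IsProbabilityMeasure ℙ]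
    (X Y : Ω → ℝ) (a b t K : ℝ) (i j : ℕ) (ha : 0 < a) (hb : 0 < b) (ht : 0 < t) (hK : 0 ≤ K)
    (hr : i / a + j / b ≤ 1 / t) (hX1 : ∀ ω, 1 ≤ X ω) (hY1 : ∀ ω, 1 ≤ Y ω)
    (hX : MemLpRV ℙ a X) (hY : MemLpRV ℙ b Y) :
    MemLpRV ℙ t (fun ω => K * (X ω ^ i * Y ω ^ j)) := by
  obtain ⟨hXm, hX0, hXi⟩ := hX
  obtain ⟨hYm, hY0, hYi⟩ := hY
  have hm : Measurable (fun ω => K * (X ω ^ i * Y ω ^ j)) :=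
    ((hXm.pow_const i).mul (hYm.pow_const j)).const_mul K
  refine ⟨hm, fun ω => ?_, ?_⟩
  · have := hX0 ω; have := hY0 ω; positivity
  refine ((hXi.add hYi).const_mul (K^t)).mono' (hm.pow_const t).aestronglyMeasurable ?_
  refine Filter.Eventually.of_forall fun ω => ?_
  have hx := hX0 ω
  have hy := hY0 ω
  have hx1 := hX1 ω
  have hy1 := hY1 ω
  rw [Real.norm_of_nonneg (by positivity), Real.mul_rpow hK (by positivity)]
  refine mul_le_mul_of_nonneg_left ?_ (by positivity)
  simp only [Pi.add_apply]
  have hw : t * i / a + t * j / b ≤ 1 := by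
    have := mul_le_mul_of_nonneg_left hr ht.le
    rw [mul_one_div_cancel ht.ne'] at this
    refine le_trans (le_of_eq ?_) this
    ring
  set Z := X ω ^ a + Y ω ^ b with hZ
  have hxa : 1 ≤ X ω ^ a := Real.one_le_rpow hx1 ha.le
  have hyb : 1 ≤ Y ω ^ b := Real.one_le_rpow hy1 hb.le
  have hZ1 : 1 ≤ Z := by linarith
  calc (X ω ^ i * Y ω ^ j) ^ t = (X ω ^ a) ^ (t * i / a) * (Y ω ^ b) ^ (t * j / b) := by
        rw [Real.mul_rpow (by positivity) (by positivity), ← Real.rpow_mul hx, ← Real.rpow_mul hy,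
          mul_div_cancel₀ _ ha.ne', mul_div_cancel₀ _ hb.ne', ← Real.rpow_natCast,
          ← Real.rpow_natCast, ← Real.rpow_mul hx, ← Real.rpow_mul hy, mul_comm t, mul_comm t]
    _ ≤ Z ^ (t * i / a) * Z ^ (t * j / b) := by
        gcongr <;> linarith
    _ = Z ^ (t * i / a + t * j / b) := by rw [Real.rpow_add (by linarith)]
    _ ≤ Z ^ (1:ℝ) := Real.rpow_le_rpow_of_exponent_le hZ1 hw
    _ = Z := Real.rpow_one _

theorem half_rpow (x y e : ℝ) (hx : 0 < x) (h1 : x / 2 ≤ y) (h2 : y ≤ x) :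
    y ^ e ≤ 2 ^ |e| * x ^ e := by
  have hy : 0 < y := by linarith
  rcases le_total 0 e with he | he
  · have : (1:ℝ) ≤ 2 ^ |e| := Real.one_le_rpow (by norm_num) (abs_nonneg e)
    have h3 : y ^ e ≤ x ^ e := Real.rpow_le_rpow hy.le h2 he
    have : 0 < x ^ e := by positivity
    nlinarith
  · rw [abs_of_nonpos he]
    calc y ^ e ≤ (x/2) ^ e := Real.rpow_le_rpow_of_nonpos (by positivity) h1 he
      _ = _ := by
        rw [Real.div_rpow hx.le (by norm_num), Real.rpow_neg (by norm_num)]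
        field_simp

/-- multi-block decay -/
theorem block_decay {Ω : Type*} (τ : Ω → Ω) (P : ℕ → Ω → ℝ) (hP0 : ∀ n ω, 0 ≤ P n ω)
    (hPadd : ∀ a b ω, P (a+b) ω = P a ω * P b (τ^[a] ω)) (ω : Ω) (E : Ω → ℝ) (a₀ θ F : ℝ)
    (hF : 1 ≤ F) (hdec : ∀ k n, P n (τ^[k] ω) ≤ E (τ^[k] ω) * ((n:ℝ)+1)^(-a₀))
    (hE : ∀ k : ℕ, E (τ^[k] ω) ≤ F * ((k:ℝ)+1)^θ) (hθ : 0 ≤ θ) (m : ℕ) :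
    ∀ n : ℕ, P n ω ≤ (∏ i ∈ Finset.range m, 2 ^ (|-(((i:ℝ)+1) * a₀ - i * θ)| + |-a₀|)) * F ^ (m+1)
      * ((n:ℝ)+1) ^ (-(((m:ℝ)+1) * a₀ - m * θ)) := by
  induction m with
  | zero =>
    intro n
    have h1 := hdec 0 n
    have h2 := hE 0
    simp at h1 h2 ⊢
    refine h1.trans ?_
    gcongr
  | succ m ih =>
    intro n
    obtain ⟨a, b, hab, h1, h2⟩ : ∃ a b : ℕ, n = a + b ∧ n + 1 ≤ 2 * (a+1) ∧ n + 1 ≤ 2 * (b+1) :=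
      ⟨n - n/2, n/2, by omega, by omega, by omega⟩
    have han : (a:ℝ)+1 ≤ n + 1 := by rw [hab]; push_cast; linarith [(Nat.cast_nonneg b : (0:ℝ) ≤ b)]
    have hbn : (b:ℝ)+1 ≤ n + 1 := by rw [hab]; push_cast; linarith [(Nat.cast_nonneg a : (0:ℝ) ≤ a)]
    have h1' : ((n:ℝ)+1)/2 ≤ a + 1 := by
      have : ((n:ℝ)+1) ≤ 2 * (a+1) := by exact_mod_cast h1
      linarith
    have h2' : ((n:ℝ)+1)/2 ≤ b + 1 := by
      have : ((n:ℝ)+1) ≤ 2 * (b+1) := by exact_mod_cast h2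
      linarith
    have hn : (0:ℝ) < (n:ℝ)+1 := by positivity
    have e1 := half_rpow _ _ (-(((m:ℝ)+1) * a₀ - m * θ)) hn h1' han
    have e2 := half_rpow _ _ (-a₀) hn h2' hbn
    have e3 : P b (τ^[a] ω) ≤ F * ((n:ℝ)+1)^θ * (2 ^ |-a₀| * ((n:ℝ)+1) ^ (-a₀)) := by
      refine (hdec a b).trans ?_
      have : E (τ^[a] ω) ≤ F * ((n:ℝ)+1)^θ := (hE a).trans (by gcongr)
      gcongr
    have e4 := ih a
    rw [Finset.prod_range_succ]
    set K := ∏ i ∈ Finset.range m, (2:ℝ) ^ (|-(((i:ℝ)+1) * a₀ - i * θ)| + |-a₀|) with hK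
    have hK0 : 0 ≤ K := Finset.prod_nonneg fun i _ => by positivity
    have e5 : P a ω ≤ K * F^(m+1) * (2 ^ |-(((m:ℝ)+1) * a₀ - m * θ)| *
        ((n:ℝ)+1) ^ (-(((m:ℝ)+1) * a₀ - m * θ))) := e4.trans (by gcongr)
    have e7 : P n ω = P a ω * P b (τ^[a] ω) := by rw [hab, hPadd]
    have e6 := mul_le_mul e5 e3 (hP0 _ _) (by positivity)
    rw [← e7] at e6
    refine e6.trans (le_of_eq ?_)
    have : -((((m+1:ℕ):ℝ)+1) * a₀ - ((m+1:ℕ):ℝ) * θ) = -(((m:ℝ)+1) * a₀ - m * θ) + θ + (-a₀) := by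
      push_cast; ring
    rw [this, Real.rpow_add hn, Real.rpow_add hn, Real.rpow_add (by norm_num : (0:ℝ) < 2)]
    ring

theorem rpow_cmp (n : ℕ) (hn : 1 ≤ n) (e f : ℝ) (he : 0 ≤ e) (hf : f ≤ e) :
    ((n:ℝ)+1) ^ (-e) ≤ (n:ℝ) ^ (-f) := by
  have h1 : (1:ℝ) ≤ n := by exact_mod_cast hn
  calc ((n:ℝ)+1) ^ (-e) ≤ (n:ℝ) ^ (-e) :=
        Real.rpow_le_rpow_of_nonpos (by linarith) (by linarith) (by linarith)
    _ ≤ _ := Real.rpow_le_rpow_of_exponent_le h1 (by linarith)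

theorem stmt_9
    {Ω : Type*} [MeasurableSpace Ω] (ℙ : Measure Ω) [IsProbabilityMeasure ℙ]
    (σ σinv : Ω → Ω)
    (hσ : MeasurePreserving σ ℙ ℙ) (hσinv : Measurable σinv)
    (hinv₁ : Function.LeftInverse σinv σ) (hinv₂ : Function.RightInverse σinv σ)
    (γ : Ω → ℝ) (hγpos : ∀ ω, 0 < γ ω) (q : ℝ) (hq : 1 < q) (hγq : MemLpRV ℙ q γ)
    (c : Ω → ℝ) (p : ℝ) (hp : 1 < p) (hc : MemLpRV ℙ p c)
    -- the decay condition
    (a₀ q₀ : ℝ) (ha₀pos : 0 < a₀) (hq₀ : 0 < q₀)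
    (E : Ω → ℝ) (hE1 : ∀ ω, 1 ≤ E ω) (hE : MemLpRV ℙ q₀ E)
    (hdecay : ∀ᵐ ω ∂ℙ, ∀ n : ℕ, 1 ≤ n →
      max (∏ j ∈ Finset.range n, (γ (σ^[j] ω))⁻¹)
          (∏ j ∈ Finset.Ico 1 n, (γ (σinv^[j] ω))⁻¹) ≤ E ω * (n : ℝ) ^ (-a₀))
    (ha₀ : 1 + 1 / p + 1 / q₀ + 1 / q < a₀)
    (s t u u₁ : ℝ)
    (hs : 1 / s = 1 / p + 1 / q + 1 / q₀)
    (ht : 1 / t = 2 / q₀ + 1 / p + 1 / q)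
    (hu : 1 / u = 7 / q₀ + 2 / p + 2 / q)
    (hu₁ : 1 / u₁ = 4 / q₀ + 3 / s + 2 / q) :
    ∃ δ₀ : ℝ, 0 < δ₀ ∧ ∀ δ : ℝ, 0 < δ → δ ≤ δ₀ →
      (∃ C : Ω → ℝ, (∀ ω, 1 ≤ C ω) ∧ MemLpRV ℙ t C ∧
        ∀ᵐ ω ∂ℙ, ∀ n : ℕ, 1 ≤ n → ∀ z : ℕ → ℝ → ℝ,
          (∀ j, 1 ≤ j → j ≤ n → ContDiff ℝ 4 (z j)) →
          (∀ j, 1 ≤ j → j ≤ n → ∀ x : ℝ,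
            |deriv (z j) x| ≤ (γ (σinv^[j] ω))⁻¹ ∧
            |iteratedDeriv 2 (z j) x| ≤ c (σinv^[j] ω) ∧
            |iteratedDeriv 3 (z j) x| ≤ c (σinv^[j] ω) ∧
            |iteratedDeriv 4 (z j) x| ≤ c (σinv^[j] ω)) →
          ∀ x : ℝ,
            |iteratedDeriv 2 (compSeq z n) x| ≤ C ω * (n : ℝ) ^ (-(a₀ - 1 - 1 / s - δ))) ∧
      (a₀ > 1 / 2 →
        min (2 * a₀ - 1 / s - 1 / p - 2 / q₀ - 1 - 4 * δ) (3 * a₀ - 3 / q₀ - 2 / p - 4 * δ)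
          > 0 →
        ∃ A : Ω → ℝ, (∀ ω, 1 ≤ A ω) ∧ MemLpRV ℙ u A ∧
          ∀ᵐ ω ∂ℙ, ∀ n : ℕ, 1 ≤ n → ∀ z : ℕ → ℝ → ℝ,
            (∀ j, 1 ≤ j → j ≤ n → ContDiff ℝ 4 (z j)) →
            (∀ j, 1 ≤ j → j ≤ n → ∀ x : ℝ,
              |deriv (z j) x| ≤ (γ (σinv^[j] ω))⁻¹ ∧
              |iteratedDeriv 2 (z j) x| ≤ c (σinv^[j] ω) ∧
              |iteratedDeriv 3 (z j) x| ≤ c (σinv^[j] ω) ∧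
              |iteratedDeriv 4 (z j) x| ≤ c (σinv^[j] ω)) →
            ∀ x : ℝ,
              |iteratedDeriv 3 (compSeq z n) x| ≤
                A ω * (n : ℝ) ^
                  (-(min (2 * a₀ - 1 / s - 1 / p - 2 / q₀ - 1 - 4 * δ)
                      (3 * a₀ - 3 / q₀ - 2 / p - 4 * δ)))) ∧
      (4 * a₀ - 3 - 3 / s - δ > 0 →
        ∃ R : Ω → ℝ, (∀ ω, 1 ≤ R ω) ∧ MemLpRV ℙ u₁ R ∧
          ∀ᵐ ω ∂ℙ, ∀ n : ℕ, 1 ≤ n → ∀ z : ℕ → ℝ → ℝ,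
            (∀ j, 1 ≤ j → j ≤ n → ContDiff ℝ 4 (z j)) →
            (∀ j, 1 ≤ j → j ≤ n → ∀ x : ℝ,
              |deriv (z j) x| ≤ (γ (σinv^[j] ω))⁻¹ ∧
              |iteratedDeriv 2 (z j) x| ≤ c (σinv^[j] ω) ∧
              |iteratedDeriv 3 (z j) x| ≤ c (σinv^[j] ω) ∧
              |iteratedDeriv 4 (z j) x| ≤ c (σinv^[j] ω)) →
            ∀ x : ℝ,
              |iteratedDeriv 4 (compSeq z n) x| ≤
                R ω * (n : ℝ) ^ (-(4 * a₀ - 3 - 3 / s - δ))) := by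
  have hp0 : 0 < p := by linarith
  have hq0 : 0 < q := by linarith
  have ip : 0 < 1 / p := by positivity
  have iq : 0 < 1 / q := by positivity
  have iq₀ : 0 < 1 / q₀ := by positivity
  have hτ : MeasurePreserving σinv ℙ ℙ := by
    refine ⟨hσinv, ?_⟩
    conv_lhs => rw [← hσ.map_eq]
    rw [Measure.map_map hσinv hσ.measurable, hinv₁.comp_eq_id, Measure.map_id]
  obtain ⟨F, hF1, hFm, hF⟩ := sup_lemma ℙ σinv hτ E q₀ (1/q₀ + 1) hq₀
    (by rw [add_mul, one_div_mul_cancel hq₀.ne']; linarith) hE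
  obtain ⟨r, hr⟩ : ∃ r : ℝ, 1 / r = 1 / q + 1 / p := ⟨1 / (1 / q + 1 / p), by rw [one_div_one_div]⟩
  have hr0 : 0 < r := one_div_pos.1 (by rw [hr]; positivity)
  have hX := prod_memLp ℙ γ c q p r hq0 hp0 hr hγq hc
  have hX' : MemLpRV ℙ r (fun ω => γ (σinv ω) * c (σinv ω)) :=
    ⟨hX.1.comp hσinv, fun ω => hX.2.1 _, hτ.integrable_comp_of_integrable hX.2.2⟩
  obtain ⟨D, hD1, hDm, hD⟩ := sup_lemma ℙ σinv hτ _ r (1/r + 1/q₀) hr0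
    (by rw [add_mul, one_div_mul_cancel hr0.ne']; have : 0 < 1/q₀ * r := by positivity
        linarith) hX'
  have hsum : Summable fun k : ℕ => ((k:ℝ)+1)^(1/r + 1/q₀ + (-a₀)) := by
    have := (summable_nat_add_iff 1).2 (Real.summable_nat_rpow.2
      (by rw [hr]; linarith : 1/r + 1/q₀ + (-a₀) < -1))
    simpa using this
  obtain ⟨K, hK1, hK⟩ : ∃ K : ℝ, 1 ≤ K ∧ ∀ n : ℕ,
      ∑ k ∈ Finset.range n, ((k:ℝ)+1)^(1/r + 1/q₀ + (-a₀)) ≤ K := by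
    refine ⟨1 + ∑' k : ℕ, ((k:ℝ)+1)^(1/r + 1/q₀ + (-a₀)), ?_, fun n => ?_⟩
    · have : 0 ≤ ∑' k : ℕ, ((k:ℝ)+1)^(1/r + 1/q₀ + (-a₀)) := tsum_nonneg fun k => by positivity
      linarith
    · have := hsum.sum_le_tsum (Finset.range n) (fun k _ => by positivity)
      linarith
  set P : ℕ → Ω → ℝ := fun n ω => ∏ i ∈ Finset.range n, (γ (σinv^[i+1] ω))⁻¹ with hPdef
  have hP0 : ∀ n ω, 0 ≤ P n ω := fun n ω =>
    Finset.prod_nonneg fun i _ => (inv_pos.2 (hγpos _)).le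
  have hPadd : ∀ a b ω, P (a+b) ω = P a ω * P b (σinv^[a] ω) := by
    intro a b ω
    simp only [hPdef]
    rw [Finset.prod_range_add]
    congr 1
    refine Finset.prod_congr rfl fun i _ => ?_
    rw [← Function.iterate_add_apply, show i + 1 + a = a + i + 1 by ring]
  have hdecP : ∀ᵐ ω ∂ℙ, ∀ k n, P n (σinv^[k] ω) ≤ E (σinv^[k] ω) * ((n:ℝ)+1)^(-a₀) := by
    rw [ae_all_iff]
    intro k
    filter_upwards [(hτ.iterate k).quasiMeasurePreserving.ae hdecay] with ω hω n
    have h := (le_max_right _ _).trans (hω (n+1) (by omega))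
    rw [Finset.prod_Ico_eq_prod_range] at h
    simp only [Nat.add_sub_cancel] at h
    push_cast at h
    refine le_trans (le_of_eq ?_) h
    refine Finset.prod_congr rfl fun i _ => ?_
    rw [add_comm 1 i]
  obtain ⟨B, hB1, hB⟩ : ∃ B : ℕ → ℝ, (∀ m, 1 ≤ B m) ∧ ∀ᵐ ω ∂ℙ, ∀ m n : ℕ, P n ω ≤ B m * F ω ^ (m+1)
      * ((n:ℝ)+1) ^ (-(((m:ℝ)+1) * a₀ - m * (1/q₀ + 1))) := by
    refine ⟨fun m => 1 + (∏ i ∈ Finset.range m,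
      2 ^ (|-(((i:ℝ)+1) * a₀ - i * (1/q₀ + 1))| + |-a₀|)), fun m => ?_, ?_⟩
    · have : 0 ≤ (∏ i ∈ Finset.range m,
        (2:ℝ) ^ (|-(((i:ℝ)+1) * a₀ - i * (1/q₀ + 1))| + |-a₀|)) :=
        Finset.prod_nonneg fun i _ => by positivity
      linarith
    · filter_upwards [hdecP, hF] with ω h1 h2 m n
      refine (block_decay σinv P hP0 hPadd ω E a₀ (1/q₀+1) (F ω) (hF1 ω) h1 h2
        (by positivity) m n).trans ?_
      have := hF1 ω
      gcongr
      linarith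
  have key : ∀ᵐ ω ∂ℙ, ∀ n : ℕ, 1 ≤ n → ∀ z : ℕ → ℝ → ℝ,
          (∀ j, 1 ≤ j → j ≤ n → ContDiff ℝ 4 (z j)) →
          (∀ j, 1 ≤ j → j ≤ n → ∀ x : ℝ,
            |deriv (z j) x| ≤ (γ (σinv^[j] ω))⁻¹ ∧
            |iteratedDeriv 2 (z j) x| ≤ c (σinv^[j] ω) ∧
            |iteratedDeriv 3 (z j) x| ≤ c (σinv^[j] ω) ∧
            |iteratedDeriv 4 (z j) x| ≤ c (σinv^[j] ω)) →
          ∀ x : ℝ,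
            |iteratedDeriv 2 (compSeq z n) x| ≤ P n ω * (K * (F ω * D ω)) ∧
            |iteratedDeriv 3 (compSeq z n) x| ≤ P n ω * (4 * K^2 * (F ω * D ω)^2) ∧
            |iteratedDeriv 4 (compSeq z n) x| ≤ P n ω * (26 * K^3 * (F ω * D ω)^3) := by
    filter_upwards [hdecP, hF, hD] with ω h1 h2 h3 n hn z hz hzb x
    have hF1' := hF1 ω
    have hD1' := hD1 ω
    have h4 : ∀ i, P i ω ≤ F ω * ((i:ℝ)+1)^(-a₀) := by
      intro i
      have e1 := h1 0 i
      have e2 := h2 0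
      simp at e1 e2
      exact e1.trans (by gcongr)
    set T : ℕ → ℝ := fun n => ∑ i ∈ Finset.range n,
      c (σinv^[i+1] ω) / (γ (σinv^[i+1] ω))⁻¹ * P i ω with hT
    have hTS : ∀ i, T i ≤ K * (F ω * D ω) := by
      intro i
      calc T i ≤ ∑ k ∈ Finset.range i, (F ω * D ω) * ((k:ℝ)+1)^(1/r + 1/q₀ + (-a₀)) := by
            refine Finset.sum_le_sum fun k _ => ?_
            have e3 := h3 k
            rw [div_inv_eq_mul, mul_comm (c _)]
            rw [← Function.iterate_succ_apply' σinv k ω] at e3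
            have hg := hγpos (σinv^[k+1] ω)
            have hcn := hc.2.1 (σinv^[k+1] ω)
            refine (mul_le_mul e3 (h4 k) (hP0 _ _) (by positivity)).trans (le_of_eq ?_)
            rw [Real.rpow_add (by positivity : (0:ℝ) < (k:ℝ)+1) _ (-a₀)]
            ring
        _ = (F ω * D ω) * ∑ k ∈ Finset.range i, ((k:ℝ)+1)^(1/r + 1/q₀ + (-a₀)) := by
            rw [Finset.mul_sum]
        _ ≤ (F ω * D ω) * K := by
            have := hK i
            gcongr
        _ = _ := by ring
    have hM : ∀ i, P i ω ≤ F ω := by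
      intro i
      refine (h4 i).trans ?_
      have : ((i:ℝ)+1)^(-a₀) ≤ 1 := Real.rpow_le_one_of_one_le_of_nonpos
        (by linarith [(Nat.cast_nonneg i : (0:ℝ) ≤ i)]) (by linarith)
      nlinarith
    obtain ⟨-, hb⟩ := compSeq_bounds (fun i => (γ (σinv^[i+1] ω))⁻¹) (fun i => c (σinv^[i+1] ω))
      (fun i => inv_pos.2 (hγpos _)) (fun i => hc.2.1 _) (fun i => P i ω) T (by simp [hPdef])
      (fun i => by simp only [hPdef]; rw [Finset.prod_range_succ]) (by simp [hT])
      (fun i => by simp only [hT]; rw [Finset.sum_range_succ]) (F ω) (K * (F ω * D ω)) hM hTS n z hz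
      (fun j hj1 hj2 x => by
        have := hzb j hj1 hj2 x
        simpa only [Nat.sub_add_cancel hj1] using this) n le_rfl
    obtain ⟨-, b2, b3, b4⟩ := hb x
    have hPn := hP0 n ω
    have hTn := hTS n
    generalize iteratedDeriv 2 (compSeq z n) x = Y2 at *
    generalize iteratedDeriv 3 (compSeq z n) x = Y3 at *
    generalize iteratedDeriv 4 (compSeq z n) x = Y4 at *
    have hFX : F ω ≤ F ω * D ω := le_mul_of_one_le_right (by linarith) hD1'
    have hX1 : 1 ≤ F ω * D ω := hF1'.trans hFX
    generalize F ω * D ω = X at *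
    have hFX' : F ω ≤ K * X := hFX.trans (le_mul_of_one_le_left (by linarith) hK1)
    have hF0 : 0 ≤ F ω := by linarith
    have hS0 : 0 ≤ K * X := by positivity
    have hTn0 : 0 ≤ T n := Finset.sum_nonneg fun i _ =>
      mul_nonneg (div_nonneg (hc.2.1 _) (inv_pos.2 (hγpos _)).le) (hP0 _ _)
    refine ⟨b2.trans (by gcongr), b3.trans ?_, b4.trans ?_⟩
    · calc P n ω * T n * (F ω + 3 * (K * X)) ≤ P n ω * (K * X) * (K * X + 3 * (K * X)) := by gcongr
        _ = _ := by ring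
    · calc _ ≤ P n ω * (K * X) * ((K * X)^2 + 6 * (K * X) * (K * X) + 3 * (K * X)^2
            + 4 * (K * X) * (K * X + 3 * (K * X))) := by gcongr
        _ = _ := by ring
  have ht0 : 0 < t := one_div_pos.1 (by rw [ht]; positivity)
  have hu0 : 0 < u := one_div_pos.1 (by rw [hu]; positivity)
  have hs3 : 3 / s = 3 * (1 / s) := by ring
  have hu10 : 0 < u₁ := one_div_pos.1 (by rw [hu₁, hs3, hs]; positivity)
  have one_le : ∀ (k : ℝ) (i j : ℕ) (ω : Ω), 1 ≤ k → 1 ≤ k * (F ω ^ i * D ω ^ j) := by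
    intro k i j ω hk
    have e1 : 1 ≤ F ω ^ i := one_le_pow₀ (hF1 ω)
    have e2 : 1 ≤ D ω ^ j := one_le_pow₀ (hD1 ω)
    exact one_le_mul_of_one_le_of_one_le hk (one_le_mul_of_one_le_of_one_le e1 e2)
  have c2 : ∀ y : ℝ, 2 / y = 2 * (1 / y) := fun y => by ring
  have c3 : ∀ y : ℝ, 3 / y = 3 * (1 / y) := fun y => by ring
  have c4 : ∀ y : ℝ, 4 / y = 4 * (1 / y) := fun y => by ring
  have c7 : ∀ y : ℝ, 7 / y = 7 * (1 / y) := fun y => by ring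
  refine ⟨1, one_pos, fun δ hδ _ => ⟨?_, fun _ _ => ?_, fun _ => ?_⟩⟩
  · have hk : 1 ≤ B 0 * K := one_le_mul_of_one_le_of_one_le (hB1 0) hK1
    refine ⟨fun ω => B 0 * K * (F ω ^ 2 * D ω ^ 1), fun ω => one_le _ _ _ _ hk,
      mon_memLp ℙ F D q₀ r t _ 2 1 hq₀ hr0 ht0 (by linarith) ?_ hF1 hD1 hFm hDm, ?_⟩
    · push_cast; rw [hr, ht]; linarith
    · filter_upwards [key, hB] with ω h1 h2 n hn z hz hzb x
      have hF1' := hF1 ω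
      have hD1' := hD1 ω
      have h3 := h2 0 n
      have h4 := rpow_cmp n hn (((((0:ℕ):ℝ))+1) * a₀ - ((0:ℕ):ℝ) * (1/q₀ + 1))
        (a₀ - 1 - 1 / s - δ) (by push_cast; linarith) (by push_cast; rw [hs]; linarith)
      have hb := hB1 0
      calc _ ≤ _ := (h1 n hn z hz hzb x).1
        _ ≤ (B 0 * F ω ^ (0+1) * (n:ℝ) ^ (-(a₀ - 1 - 1 / s - δ))) * (K * (F ω * D ω)) := by
          gcongr
          exact h3.trans (by gcongr)
        _ = _ := by ring
  · have hk : 1 ≤ B 1 * (4 * K^2) := one_le_mul_of_one_le_of_one_le (hB1 1) (by nlinarith)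
    refine ⟨fun ω => B 1 * (4 * K^2) * (F ω ^ 4 * D ω ^ 2), fun ω => one_le _ _ _ _ hk,
      mon_memLp ℙ F D q₀ r u _ 4 2 hq₀ hr0 hu0 (by linarith) ?_ hF1 hD1 hFm hDm, ?_⟩
    · push_cast; rw [c2 r, hr, hu, c4, c7, c2, c2]; linarith
    · filter_upwards [key, hB] with ω h1 h2 n hn z hz hzb x
      have hF1' := hF1 ω
      have hD1' := hD1 ω
      have h3 := h2 1 n
      have h4 := rpow_cmp n hn (((((1:ℕ):ℝ))+1) * a₀ - ((1:ℕ):ℝ) * (1/q₀ + 1))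
        (min (2 * a₀ - 1 / s - 1 / p - 2 / q₀ - 1 - 4 * δ) (3 * a₀ - 3 / q₀ - 2 / p - 4 * δ))
        (by push_cast; linarith)
        ((min_le_left _ _).trans (by push_cast; rw [hs, c2]; linarith))
      have hb := hB1 1
      set W := (n:ℝ) ^ (-(min (2 * a₀ - 1 / s - 1 / p - 2 / q₀ - 1 - 4 * δ)
        (3 * a₀ - 3 / q₀ - 2 / p - 4 * δ)))
      calc _ ≤ _ := (h1 n hn z hz hzb x).2.1
        _ ≤ (B 1 * F ω ^ (1+1) * W) * (4 * K^2 * (F ω * D ω)^2) := by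
          gcongr
          exact h3.trans (by gcongr)
        _ = _ := by ring
  · have hk : 1 ≤ B 3 * (26 * K^3) := one_le_mul_of_one_le_of_one_le (hB1 3)
      (by have := one_le_pow₀ (n := 3) hK1; linarith)
    refine ⟨fun ω => B 3 * (26 * K^3) * (F ω ^ 7 * D ω ^ 3), fun ω => one_le _ _ _ _ hk,
      mon_memLp ℙ F D q₀ r u₁ _ 7 3 hq₀ hr0 hu10 (by linarith) ?_ hF1 hD1 hFm hDm, ?_⟩
    · push_cast; rw [c3 r, hr, hu₁, c4, c7, c2, c3, hs]; linarith
    · filter_upwards [key, hB] with ω h1 h2 n hn z hz hzb x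
      have hF1' := hF1 ω
      have hD1' := hD1 ω
      have h3 := h2 3 n
      have h4 := rpow_cmp n hn (((((3:ℕ):ℝ))+1) * a₀ - ((3:ℕ):ℝ) * (1/q₀ + 1))
        (4 * a₀ - 3 - 3 / s - δ)
        (by push_cast; linarith)
        (by push_cast; rw [c3, hs]; linarith)
      have hb := hB1 3
      set W := (n:ℝ) ^ (-(4 * a₀ - 3 - 3 / s - δ))
      calc _ ≤ _ := (h1 n hn z hz hzb x).2.2
        _ ≤ (B 3 * F ω ^ (3+1) * W) * (26 * K^3 * (F ω * D ω)^3) := by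
          gcongr
          exact h3.trans (by gcongr)
        _ = _ := by ring
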